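/- Let r be a prime, f ≥ 1 an integer, m₂ a nonzero integer and q an integer with r ∤ q, and let b, c, d be integers. Define S₂(r^f,q,m₂;b,c,d) = Σ_{α,β,γ=1}^{r^f}, restricted to triples with r^f ∣ m₂α²β − qγ, of e((bα + cβ + dγ)/r^f), where e(x) = e^{2πix}. Then: (i) |S₂(r,q,m₂;b,c,d)| ≤ 2r·gcd(r,b,c,dm₂); (ii) if r is odd and f ≥ 2, then |S₂(r^f,q,m₂;b,c,d)| ≤ 2·r^{3f/2}·gcd(r^f,b,c,dm₂)^{1/2}; (iii) if r = 2 and f ≥ 2, then |S₂(2^f,q,m₂;b,c,d)| ≤ 4·2^{3f/2}·gcd(2^f,b,c,dm₂)^{1/2}. -/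

import Mathlib

open scoped BigOperators

/-- `e(x) = e^{2πix}`. -/
noncomputable def eC (x : ℝ) : ℂ := Complex.exp (2 * Real.pi * Complex.I * x)

/-- The complete exponential sum
`S₂(R,q,m₂;b,c,d) = Σ_{α,β,γ=1, R ∣ m₂α²β − qγ}^{R} e((bα + cβ + dγ)/R)`. -/
noncomputable def S2 (R : ℕ) (q m₂ b c d : ℤ) : ℂ :=
  ∑ α ∈ Finset.Icc 1 R, ∑ β ∈ Finset.Icc 1 R, ∑ γ ∈ Finset.Icc 1 R,
    if (R : ℤ) ∣ m₂ * (α : ℤ) ^ 2 * β - q * γ then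
      eC (((b * α + c * β + d * γ : ℤ) : ℝ) / R)
    else 0

lemma aux_sum_Icc (R : ℕ) [NeZero R] (F : ZMod R → ℂ) :
    ∑ a ∈ Finset.Icc 1 R, F (a : ZMod R) = ∑ x : ZMod R, F x := by
  have hR : 0 < R := NeZero.pos R
  have h1 : ∑ a ∈ Finset.Icc 1 R, F (a : ZMod R) = ∑ a ∈ Finset.range R, F (a : ZMod R) := by
    rw [← Finset.Ico_add_one_right_eq_Icc, Finset.sum_Ico_eq_sum_range]
    have e := Finset.sum_range_succ (fun a : ℕ => F (a : ZMod R)) R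
    have e' := Finset.sum_range_succ' (fun a : ℕ => F (a : ZMod R)) R
    rw [e] at e'
    simp only [Nat.cast_zero, ZMod.natCast_self] at e'
    simp only [Nat.add_sub_cancel, Nat.add_comm 1]
    exact (add_right_cancel e').symm
  rw [h1]
  refine Finset.sum_bij' (fun a _ => (a : ZMod R)) (fun x _ => x.val) ?_ ?_ ?_ ?_ ?_
  · simp
  · intro x _; simpa using ZMod.val_lt x
  · intro a ha; exact ZMod.val_cast_of_lt (by simpa using ha)
  · intro x _; simp
  · simp

lemma aux_eC (R : ℕ) [NeZero R] (n : ℤ) :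
    eC ((n : ℝ) / R) = ZMod.stdAddChar (N := R) (n : ZMod R) := by
  rw [ZMod.stdAddChar_coe, eC]
  congr 1
  push_cast
  ring

lemma aux_S2 (R : ℕ) [NeZero R] (q m b c d v : ℤ) (hv : (q : ZMod R) * v = 1) :
    S2 R q m b c d = R * ∑ α ∈ (Finset.univ : Finset (ZMod R)).filter
      (fun α => (c : ZMod R) + d * v * m * α ^ 2 = 0), ZMod.stdAddChar (N := R) (b * α) := by
  classical
  have h1 : S2 R q m b c d = ∑ α : ZMod R, ∑ β : ZMod R, ∑ γ : ZMod R,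
      if (m : ZMod R) * α ^ 2 * β - q * γ = 0 then
        ZMod.stdAddChar (N := R) (b * α + c * β + d * γ) else 0 := by
    rw [S2, ← aux_sum_Icc]
    refine Finset.sum_congr rfl fun α _ => ?_
    rw [← aux_sum_Icc]
    refine Finset.sum_congr rfl fun β _ => ?_
    rw [← aux_sum_Icc]
    refine Finset.sum_congr rfl fun γ _ => ?_
    rw [aux_eC]
    have e := ZMod.intCast_zmod_eq_zero_iff_dvd (m * (α : ℤ) ^ 2 * β - q * γ) R
    push_cast at e ⊢
    exact if_congr e.symm rfl rfl
  rw [h1, Finset.mul_sum, Finset.sum_filter]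
  refine Finset.sum_congr rfl fun α _ => ?_
  have h2 : ∀ β : ZMod R, (∑ γ : ZMod R,
      if (m : ZMod R) * α ^ 2 * β - q * γ = 0 then
        ZMod.stdAddChar (N := R) (b * α + c * β + d * γ) else 0)
      = ZMod.stdAddChar (N := R) (b * α) *
        ZMod.stdAddChar (N := R) (β * (c + d * v * m * α ^ 2)) := by
    intro β
    rw [Finset.sum_eq_single ((v : ZMod R) * m * α ^ 2 * β)]
    · rw [if_pos (by linear_combination (-(m : ZMod R) * α ^ 2 * β) * hv), ← AddChar.map_add_eq_mul]
      congr 1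
      ring
    · intro γ _ hγ
      rw [if_neg]
      intro h
      exact hγ (by linear_combination (-(v : ZMod R)) * h - γ * hv)
    · simp
  rw [Finset.sum_congr rfl fun β _ => h2 β, ← Finset.mul_sum,
    AddChar.sum_mulShift _ (ZMod.isPrimitive_stdAddChar R), ZMod.card]
  split_ifs <;> simp [mul_comm]

lemma aux_split (r : ℕ) (hr : r.Prime) (n m : ℕ) (hm : 2 * m ≤ n + 1) (u v : ℤ)
    (h : ((r ^ n : ℕ) : ℤ) ∣ u * v) : ((r ^ m : ℕ) : ℤ) ∣ u ∨ ((r ^ m : ℕ) : ℤ) ∣ v := by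
  rw [Int.natCast_dvd, Int.natAbs_mul] at h
  rw [Int.natCast_dvd, Int.natCast_dvd]
  obtain ⟨a, b, ha, hb, hab⟩ := exists_dvd_and_dvd_of_dvd_mul h
  obtain ⟨i, -, rfl⟩ := (Nat.dvd_prime_pow hr).1 ⟨b, hab⟩
  obtain ⟨j, -, rfl⟩ := (Nat.dvd_prime_pow hr).1 (Dvd.intro_left _ hab.symm)
  rw [← pow_add] at hab
  have := Nat.pow_right_injective hr.two_le hab
  rcases le_or_gt m i with h1 | h1
  · exact Or.inl ((pow_dvd_pow _ h1).trans ha)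
  · exact Or.inr ((pow_dvd_pow _ (by omega)).trans hb)

lemma aux_class (r f m : ℕ) (hr : r.Prime) (hm : m ≤ f) (X Y : ℤ)
    (h : ((r ^ m : ℕ) : ℤ) ∣ X - Y) :
    (X : ZMod (r ^ f)) ∈ (Finset.range (r ^ (f - m))).image
      (fun j : ℕ => (Y : ZMod (r ^ f)) + (r ^ m : ℕ) * j) := by
  obtain ⟨t, ht⟩ := h
  have hpos : (0 : ℤ) < ((r ^ (f - m) : ℕ) : ℤ) := by
    exact_mod_cast pow_pos hr.pos _
  rw [Finset.mem_image]
  refine ⟨(t % ((r ^ (f - m) : ℕ) : ℤ)).toNat, ?_, ?_⟩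
  · rw [Finset.mem_range]
    have := Int.emod_lt_of_pos t hpos
    have := Int.emod_nonneg t hpos.ne'
    omega
  · have h0 := Int.emod_nonneg t hpos.ne'
    have h1 : (((t % ((r ^ (f - m) : ℕ) : ℤ)).toNat : ℕ) : ZMod (r ^ f))
        = ((t % ((r ^ (f - m) : ℕ) : ℤ) : ℤ) : ZMod (r ^ f)) := by
      rw [← Int.cast_natCast, Int.toNat_of_nonneg h0]
    rw [h1]
    have h2 : X = Y + ((r ^ m : ℕ) : ℤ) * (t % ((r ^ (f - m) : ℕ) : ℤ))
        + ((r ^ f : ℕ) : ℤ) * (t / ((r ^ (f - m) : ℕ) : ℤ)) := by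
      have e : (r ^ f : ℕ) = r ^ m * r ^ (f - m) := by rw [← pow_add]; congr 1; omega
      rw [e]
      have := Int.emod_add_mul_ediv t ((r ^ (f - m) : ℕ) : ℤ)
      push_cast at *
      linear_combination ht - (r : ℤ) ^ m * this
    have h3 := congrArg (Int.cast : ℤ → ZMod (r ^ f)) h2
    rw [h3]
    rw [Int.cast_add, Int.cast_mul ((r ^ f : ℕ) : ℤ), Int.cast_natCast (r ^ f), ZMod.natCast_self]
    push_cast
    ring

lemma aux_count (r f k : ℕ) (hr : r.Prime) [NeZero (r ^ f)] (hk : k ≤ f) (c D v : ℤ)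
    (hD : (r ^ f).gcd D.natAbs = r ^ k) (hv : IsCoprime (r : ℤ) v) :
    ((Finset.univ : Finset (ZMod (r ^ f))).filter
      (fun α => (c : ZMod (r ^ f)) + D * v * α ^ 2 = 0)).card ≤ 2 * r ^ (k + (f - k) / 2) := by
  classical
  set A := (Finset.univ : Finset (ZMod (r ^ f))).filter
      (fun α => (c : ZMod (r ^ f)) + D * v * α ^ 2 = 0) with hA
  rcases A.eq_empty_or_nonempty with h | ⟨x0, hx0⟩
  · simp [h]
  obtain ⟨X0, rfl⟩ := ZMod.intCast_surjective x0
  have hx0' := (Finset.mem_filter.1 hx0).2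
  set m := (f - k + 1) / 2 with hm
  have hmf : m ≤ f := by omega
  have hfm : f - m = k + (f - k) / 2 := by omega
  have hsub : A ⊆ (Finset.range (r ^ (f - m))).image
      (fun j : ℕ => ((X0 : ℤ) : ZMod (r ^ f)) + (r ^ m : ℕ) * j) ∪
      (Finset.range (r ^ (f - m))).image
      (fun j : ℕ => ((-X0 : ℤ) : ZMod (r ^ f)) + (r ^ m : ℕ) * j) := by
    intro x hx
    obtain ⟨X, rfl⟩ := ZMod.intCast_surjective x
    have hx' := (Finset.mem_filter.1 hx).2
    have h1 : ((D * v * ((X - X0) * (X - -X0)) : ℤ) : ZMod (r ^ f)) = 0 := by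
      push_cast
      linear_combination hx' - hx0'
    rw [ZMod.intCast_zmod_eq_zero_iff_dvd] at h1
    have hcop : IsCoprime ((r ^ f : ℕ) : ℤ) v := by push_cast; exact hv.pow_left
    rw [mul_comm D v, mul_assoc] at h1
    have h2 := hcop.dvd_of_dvd_mul_left h1
    have h3 : ((r ^ (f - k) : ℕ) : ℤ) ∣ (X - X0) * (X - -X0) := by
      rw [Int.natCast_dvd, Int.natAbs_mul] at h2
      rw [Int.natCast_dvd]
      have h4 : r ^ f ∣ r ^ k * ((X - X0) * (X - -X0)).natAbs := by
        rw [← hD, ← Nat.gcd_mul_right]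
        exact Nat.dvd_gcd (dvd_mul_right _ _) h2
      have e : r ^ f = r ^ k * r ^ (f - k) := by rw [← pow_add]; congr 1; omega
      rw [e] at h4
      exact Nat.dvd_of_mul_dvd_mul_left (pow_pos hr.pos _) h4
    rw [Finset.mem_union]
    rcases aux_split r hr (f - k) m (by omega) _ _ h3 with h5 | h5
    · exact Or.inl (aux_class r f m hr hmf _ _ h5)
    · exact Or.inr (aux_class r f m hr hmf _ _ h5)
  refine (Finset.card_le_card hsub).trans ((Finset.card_union_le _ _).trans ?_)
  rw [← hfm, two_mul]
  refine add_le_add (Finset.card_image_le.trans ?_) (Finset.card_image_le.trans ?_) <;> simp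

lemma aux_main (r f : ℕ) (hr : r.Prime) (hf : 0 < f) (q m b c d : ℤ) (hq : ¬ (r : ℤ) ∣ q) :
    S2 (r ^ f) q m b c d = 0 ∨ ∃ k ≤ f,
      Nat.gcd (r ^ f) (Nat.gcd b.natAbs (Nat.gcd c.natAbs (d * m).natAbs)) = r ^ k ∧
      ‖S2 (r ^ f) q m b c d‖ ≤ r ^ f * (2 * r ^ (k + (f - k) / 2)) := by
  classical
  have : NeZero (r ^ f) := ⟨(pow_pos hr.pos f).ne'⟩
  have hpr : Prime (r : ℤ) := Nat.prime_iff_prime_int.1 hr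
  have hcop : IsCoprime (r : ℤ) q := (hpr.coprime_iff_not_dvd).2 hq
  obtain ⟨a, v, hav⟩ := hcop.pow_left (m := f)
  have hv : (q : ZMod (r ^ f)) * v = 1 := by
    have := congrArg (Int.cast : ℤ → ZMod (r ^ f)) hav
    push_cast at this
    have h0 : (r : ZMod (r ^ f)) ^ f = 0 := by
      have := ZMod.natCast_self (r ^ f)
      push_cast at this
      exact this
    rw [h0] at this
    linear_combination this
  have hvr : IsCoprime (r : ℤ) v := by
    refine ⟨a * r ^ (f - 1), q, ?_⟩
    rw [mul_assoc, ← pow_succ, Nat.sub_add_cancel hf]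
    linear_combination hav
  obtain ⟨k, hk, hD⟩ := (Nat.dvd_prime_pow hr).1 (Nat.gcd_dvd_left (r ^ f) (d * m).natAbs)
  rw [aux_S2 (r ^ f) q m b c d v hv]
  have hAeq : (Finset.univ : Finset (ZMod (r ^ f))).filter
      (fun α => (c : ZMod (r ^ f)) + d * v * m * α ^ 2 = 0) =
      (Finset.univ : Finset (ZMod (r ^ f))).filter
      (fun α => (c : ZMod (r ^ f)) + ((d * m : ℤ) : ZMod (r ^ f)) * v * α ^ 2 = 0) := by
    refine Finset.filter_congr fun α _ => ?_
    push_cast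
    ring_nf
  rw [hAeq]
  have hcount := aux_count r f k hr hk c (d * m) v hD hvr
  set A := (Finset.univ : Finset (ZMod (r ^ f))).filter
      (fun α => (c : ZMod (r ^ f)) + ((d * m : ℤ) : ZMod (r ^ f)) * v * α ^ 2 = 0) with hA
  set T := ∑ α ∈ A, ZMod.stdAddChar (N := r ^ f) (b * α) with hT
  by_cases hT0 : T = 0
  · left; rw [hT0, mul_zero]
  right
  have hkD : ((r ^ k : ℕ) : ℤ) ∣ d * m := by
    rw [Int.natCast_dvd, ← hD]; exact Nat.gcd_dvd_right _ _
  have hkf : ((r ^ k : ℕ) : ℤ) ∣ ((r ^ f : ℕ) : ℤ) := by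
    exact_mod_cast pow_dvd_pow r hk
  have ef : r ^ f = r ^ k * r ^ (f - k) := by rw [← pow_add]; congr 1; omega
  have hkc : ((r ^ k : ℕ) : ℤ) ∣ c := by
    have hne : A.Nonempty := by
      rw [Finset.nonempty_iff_ne_empty]
      intro h; apply hT0; rw [hT, h, Finset.sum_empty]
    obtain ⟨x, hx⟩ := hne
    obtain ⟨X, rfl⟩ := ZMod.intCast_surjective x
    have hx' := (Finset.mem_filter.1 hx).2
    have h1 : ((c + d * m * v * X ^ 2 : ℤ) : ZMod (r ^ f)) = 0 := by
      push_cast at hx' ⊢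
      exact hx'
    rw [ZMod.intCast_zmod_eq_zero_iff_dvd] at h1
    have h2 := hkf.trans h1
    rw [mul_assoc (d * m)] at h2
    exact (dvd_add_left (hkD.mul_right _)).1 h2
  have hkb : ((r ^ k : ℕ) : ℤ) ∣ b := by
    set s : ZMod (r ^ f) := ((r ^ (f - k) : ℕ) : ZMod (r ^ f)) with hs
    have hDs : ((d * m : ℤ) : ZMod (r ^ f)) * s = 0 := by
      have : ((d * m * (r ^ (f - k) : ℕ) : ℤ) : ZMod (r ^ f)) = 0 := by
        rw [ZMod.intCast_zmod_eq_zero_iff_dvd, ef, Nat.cast_mul]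
        exact mul_dvd_mul_right hkD _
      rw [hs, ← this]; push_cast; rfl
    have hmem : ∀ (s' x : ZMod (r ^ f)), ((d * m : ℤ) : ZMod (r ^ f)) * s' = 0 →
        x ∈ A → x + s' ∈ A := by
      intro s' x hs' hx
      rw [hA, Finset.mem_filter] at hx ⊢
      refine ⟨Finset.mem_univ _, ?_⟩
      linear_combination hx.2 + (v * (2 * x + s')) * hs'
    have hshift : T = ZMod.stdAddChar (N := r ^ f) (b * s) * T := by
      rw [hT, Finset.mul_sum]
      refine Finset.sum_bij' (fun x _ => x + -s) (fun x _ => x + s) ?_ ?_ ?_ ?_ ?_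
      · intro x hx; exact hmem _ _ (by rw [mul_neg, hDs, neg_zero]) hx
      · intro x hx; exact hmem _ _ hDs hx
      · intro x _; ring
      · intro x _; ring
      · intro x _
        rw [← AddChar.map_add_eq_mul]
        congr 1
        ring
    have h1 : ZMod.stdAddChar (N := r ^ f) (b * s) = 1 := by
      have : (ZMod.stdAddChar (N := r ^ f) (b * s) - 1) * T = 0 := by
        linear_combination -hshift
      rcases mul_eq_zero.1 this with h | h
      · exact sub_eq_zero.1 h
      · exact absurd h hT0
    have h2 : (b : ZMod (r ^ f)) * s = 0 := by
      apply ZMod.injective_stdAddChar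
      rw [h1, AddChar.map_zero_eq_one]
    have h3 : ((b * (r ^ (f - k) : ℕ) : ℤ) : ZMod (r ^ f)) = 0 := by
      rw [← h2, hs]; push_cast; rfl
    rw [ZMod.intCast_zmod_eq_zero_iff_dvd, ef, Nat.cast_mul] at h3
    refine Int.dvd_of_mul_dvd_mul_right ?_ h3
    exact_mod_cast (pow_pos hr.pos _).ne'
  refine ⟨k, hk, ?_, ?_⟩
  · apply Nat.dvd_antisymm
    · rw [← hD]
      refine Nat.dvd_gcd (Nat.gcd_dvd_left _ _) ?_
      exact (Nat.gcd_dvd_right _ _).trans ((Nat.gcd_dvd_right _ _).trans (Nat.gcd_dvd_right _ _))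
    · exact Nat.dvd_gcd (pow_dvd_pow r hk) (Nat.dvd_gcd (Int.natCast_dvd.1 hkb)
        (Nat.dvd_gcd (Int.natCast_dvd.1 hkc) (Int.natCast_dvd.1 hkD)))
  · rw [norm_mul]
    have h1 : ‖T‖ ≤ A.card := by
      refine (norm_sum_le _ _).trans ?_
      simp
    have h2 : (A.card : ℝ) ≤ 2 * r ^ (k + (f - k) / 2) := by exact_mod_cast hcount
    have h3 : ‖((r ^ f : ℕ) : ℂ)‖ = (r : ℝ) ^ f := by simp
    rw [h3]
    exact mul_le_mul_of_nonneg_left (h1.trans h2) (by positivity)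

lemma aux_pow (r f : ℕ) (hr : r.Prime) (hf : 0 < f) (q m b c d : ℤ) (hq : ¬ (r : ℤ) ∣ q) :
    ‖S2 (r ^ f) q m b c d‖
        ≤ 2 * (r : ℝ) ^ ((3 * (f : ℝ))/2) *
          (Nat.gcd (r ^ f) (Nat.gcd b.natAbs (Nat.gcd c.natAbs (d * m).natAbs)) : ℝ)
            ^ ((1 : ℝ)/2) := by
  have hr0 : (0 : ℝ) < r := by exact_mod_cast hr.pos
  have hr1 : (1 : ℝ) ≤ r := by exact_mod_cast hr.one_lt.le
  rcases aux_main r f hr hf q m b c d hq with h | ⟨k, hk, hg, h⟩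
  · rw [h, norm_zero]; positivity
  · rw [hg]
    refine h.trans ?_
    rw [Nat.cast_pow, ← Real.rpow_natCast (r : ℝ) k, ← Real.rpow_mul hr0.le, mul_assoc 2,
      ← Real.rpow_add hr0, mul_left_comm, ← pow_add, ← Real.rpow_natCast]
    refine mul_le_mul_of_nonneg_left (Real.rpow_le_rpow_of_exponent_le hr1 ?_) (by norm_num)
    have h1 : 2 * (f + (k + (f - k) / 2)) ≤ 3 * f + k := by omega
    have h2 : (2 : ℝ) * ((f + (k + (f - k) / 2) : ℕ) : ℝ) ≤ 3 * f + k := by exact_mod_cast h1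
    linarith

theorem statement19 (r : ℕ) (hr : r.Prime) (q m₂ : ℤ) (hm₂ : m₂ ≠ 0)
    (hrq : ¬ (r : ℤ) ∣ q) (b c d : ℤ) :
    (‖S2 r q m₂ b c d‖
        ≤ 2 * r * (Nat.gcd r (Nat.gcd b.natAbs (Nat.gcd c.natAbs (d * m₂).natAbs)) : ℝ)) ∧
    (∀ f : ℕ, 2 ≤ f → Odd r → ‖S2 (r ^ f) q m₂ b c d‖
        ≤ 2 * (r : ℝ) ^ ((3 * (f : ℝ))/2) *
          (Nat.gcd (r ^ f) (Nat.gcd b.natAbs (Nat.gcd c.natAbs (d * m₂).natAbs)) : ℝ)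
            ^ ((1 : ℝ)/2)) ∧
    (∀ f : ℕ, 2 ≤ f → r = 2 → ‖S2 (2 ^ f) q m₂ b c d‖
        ≤ 4 * (2 : ℝ) ^ ((3 * (f : ℝ))/2) *
          (Nat.gcd (2 ^ f) (Nat.gcd b.natAbs (Nat.gcd c.natAbs (d * m₂).natAbs)) : ℝ)
            ^ ((1 : ℝ)/2)) := by
  refine ⟨?_, fun f hf _ => aux_pow r f hr (by omega) q m₂ b c d hrq, ?_⟩
  · have h := aux_main r 1 hr one_pos q m₂ b c d hrq
    rw [pow_one] at h
    rcases h with h | ⟨k, hk, hg, h⟩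
    · rw [h, norm_zero]; positivity
    · rw [hg]
      refine h.trans (le_of_eq ?_)
      have : k + (1 - k) / 2 = k := by omega
      rw [this]
      push_cast
      ring
  · intro f hf h2
    subst h2
    have h := aux_pow 2 f hr (by omega) q m₂ b c d hrq
    refine h.trans ?_
    rw [Nat.cast_ofNat]
    refine mul_le_mul_of_nonneg_right (mul_le_mul_of_nonneg_right (by norm_num) ?_) ?_ <;>
      positivity
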